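/- Let G be a finite simple connected graph of order n ≥ 2 and let μ_n ≥ μ_{n−1} ≥ ⋯ ≥ μ_1 be the eigenvalues of the Laplacian matrix of G. Then β(G) ≤ n − n / μ_n. -/

import Mathlib

open SimpleGraph Finset

variable {V : Type*}

/-- `Γ` is a dominating set for `G`: every vertex not in `Γ` has a neighbor in `Γ`. -/
def IsDominatingSet (G : SimpleGraph V) (Γ : Finset V) : Prop :=
  ∀ v : V, v ∉ Γ → ∃ u ∈ Γ, G.Adj v u

/-- The domination number `γ(G)`: the minimum cardinality of a dominating set. -/
noncomputable def dominationNumber (G : SimpleGraph V) [Fintype V] : ℕ :=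
  sInf {k | ∃ Γ : Finset V, IsDominatingSet G Γ ∧ Γ.card = k}

/-- `W` is a resolving set for `G`: any two distinct vertices are distinguished by their
distance to some vertex of `W`. -/
def IsResolvingSet (G : SimpleGraph V) (W : Finset V) : Prop :=
  ∀ u v : V, u ≠ v → ∃ w ∈ W, G.dist u w ≠ G.dist v w

/-- The metric dimension `β(G)`: the minimum cardinality of a resolving set. -/
noncomputable def metricDimension (G : SimpleGraph V) [Fintype V] : ℕ :=
  sInf {k | ∃ W : Finset V, IsResolvingSet G W ∧ W.card = k}

theorem rayleigh_aux [Fintype V] [DecidableEq V] (A : Matrix V V ℝ) (hA : A.IsHermitian) (μ : ℝ)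
    (hmax : ∀ i, hA.eigenvalues i ≤ μ) (x : V → ℝ) :
    x ⬝ᵥ (A.mulVec x) ≤ μ * (x ⬝ᵥ x) := by
  have hB : (algebraMap ℝ (Matrix V V ℝ) μ - A).IsHermitian := by
    refine Matrix.IsHermitian.sub ?_ hA
    rw [Matrix.algebraMap_eq_diagonal]
    exact Matrix.isHermitian_diagonal _
  have hps : (algebraMap ℝ (Matrix V V ℝ) μ - A).PosSemidef := by
    rw [hB.posSemidef_iff_eigenvalues_nonneg]
    intro i
    have h := hB.eigenvalues_mem_spectrum_real i
    rw [← spectrum.singleton_sub_eq, hA.spectrum_real_eq_range_eigenvalues] at h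
    obtain ⟨a, rfl, b, ⟨j, rfl⟩, hab⟩ := h
    have := hmax j
    simp only [Pi.zero_apply]
    rw [← hab]
    simpa using this
  have h := hps.dotProduct_mulVec_nonneg x
  rw [Matrix.sub_mulVec, dotProduct_sub, Algebra.algebraMap_eq_smul_one, Matrix.smul_mulVec,
    Matrix.one_mulVec, dotProduct_smul] at h
  simpa using h

open Classical in
/-- Bollobás–Cockayne: a dominating set all of whose members have external private neighbours. -/
theorem exists_dominating_private [Fintype V] (G : SimpleGraph V)
    (hiso : ∀ v, ∃ w, G.Adj v w) :
    ∃ Γ : Finset V, IsDominatingSet G Γ ∧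
      ∀ u ∈ Γ, ∃ w, w ∉ Γ ∧ G.Adj u w ∧ ∀ v ∈ Γ, G.Adj v w → v = u := by
  let iso : Finset V → Finset V := fun Γ => Γ.filter (fun v => ∀ y ∈ Γ, ¬ G.Adj v y)
  let wt : Finset V → ℕ := fun Γ => (Fintype.card V + 1) * Γ.card + (iso Γ).card
  obtain ⟨Γ, hΓ, hmin⟩ := Finset.exists_min_image
    ((Finset.univ : Finset (Finset V)).filter (fun Γ => IsDominatingSet G Γ)) wt
    ⟨Finset.univ, Finset.mem_filter.2 ⟨Finset.mem_univ _, fun v hv => absurd (Finset.mem_univ v) hv⟩⟩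
  have hdom : IsDominatingSet G Γ := by simpa using hΓ
  have hmin' : ∀ Δ, IsDominatingSet G Δ → wt Γ ≤ wt Δ := fun Δ h => hmin Δ (by simpa using h)
  refine ⟨Γ, hdom, ?_⟩
  intro u hu
  by_contra hcon
  have hnp : ∀ w, w ∉ Γ → G.Adj u w → ∃ v ∈ Γ, G.Adj v w ∧ v ≠ u := by
    intro w hw huw
    by_contra h
    exact hcon ⟨w, hw, huw, fun v hv hvw => by
      by_contra hne
      exact h ⟨v, hv, hvw, hne⟩⟩
  by_cases hui : ∃ y ∈ Γ, G.Adj u y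
  · obtain ⟨y, hy, huy⟩ := hui
    have hd : IsDominatingSet G (Γ.erase u) := by
      intro v hv
      by_cases hvu : v = u
      · subst hvu
        exact ⟨y, Finset.mem_erase.2 ⟨huy.ne', hy⟩, huy⟩
      · have hvΓ : v ∉ Γ := fun h => hv (Finset.mem_erase.2 ⟨hvu, h⟩)
        obtain ⟨z, hz, hvz⟩ := hdom v hvΓ
        by_cases hzu : z = u
        · subst hzu
          obtain ⟨t, ht, htv, htu⟩ := hnp v hvΓ hvz.symm
          exact ⟨t, Finset.mem_erase.2 ⟨htu, ht⟩, htv.symm⟩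
        · exact ⟨z, Finset.mem_erase.2 ⟨hzu, hz⟩, hvz⟩
    have h1 := hmin' _ hd
    have h2 := Finset.card_erase_add_one hu
    have h3 : (iso (Γ.erase u)).card ≤ Fintype.card V := Finset.card_le_univ _
    simp only [wt] at h1
    rw [← h2] at h1
    nlinarith
  · have hui' : ∀ y ∈ Γ, ¬ G.Adj u y := fun y hy h => hui ⟨y, hy, h⟩
    obtain ⟨w, huw⟩ := hiso u
    have hwΓ : w ∉ Γ := fun h => hui' w h huw
    obtain ⟨t, ht, htw, htu⟩ := hnp w hwΓ huw
    have hwe : w ∉ Γ.erase u := fun h => hwΓ (Finset.mem_of_mem_erase h)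
    have hd : IsDominatingSet G (insert w (Γ.erase u)) := by
      intro v hv
      rw [Finset.mem_insert, not_or] at hv
      by_cases hvu : v = u
      · subst hvu
        exact ⟨w, Finset.mem_insert_self _ _, huw⟩
      · have hvΓ : v ∉ Γ := fun h => hv.2 (Finset.mem_erase.2 ⟨hvu, h⟩)
        obtain ⟨z, hz, hvz⟩ := hdom v hvΓ
        by_cases hzu : z = u
        · subst hzu
          obtain ⟨s, hs, hsv, hsu⟩ := hnp v hvΓ hvz.symm
          exact ⟨s, Finset.mem_insert_of_mem (Finset.mem_erase.2 ⟨hsu, hs⟩), hsv.symm⟩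
        · exact ⟨z, Finset.mem_insert_of_mem (Finset.mem_erase.2 ⟨hzu, hz⟩), hvz⟩
    have h1 := hmin' _ hd
    have h2 := Finset.card_erase_add_one hu
    have h4 := Finset.card_insert_of_notMem hwe
    have h3 : (iso (insert w (Γ.erase u))).card < (iso Γ).card := by
      apply Finset.card_lt_card
      rw [Finset.ssubset_iff]
      refine ⟨u, ?_, ?_⟩
      · simp only [iso, Finset.mem_filter, Finset.mem_insert, Finset.mem_erase]
        rintro ⟨h | h, -⟩
        · exact huw.ne h
        · exact h.1 rfl
      · intro y hy
        rw [Finset.mem_insert] at hy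
        rcases hy with rfl | hy
        · exact Finset.mem_filter.2 ⟨hu, hui'⟩
        · obtain ⟨hy1, hy2⟩ := Finset.mem_filter.1 hy
          rcases Finset.mem_insert.1 hy1 with rfl | hy1
          · exact absurd htw.symm
              (hy2 t (Finset.mem_insert_of_mem (Finset.mem_erase.2 ⟨htu, ht⟩)))
          · have hyΓ := Finset.mem_of_mem_erase hy1
            refine Finset.mem_filter.2 ⟨hyΓ, fun z hz hyz => ?_⟩
            by_cases hzu : z = u
            · subst hzu
              exact hui' y hyΓ hyz.symm
            · exact hy2 z (Finset.mem_insert_of_mem (Finset.mem_erase.2 ⟨hzu, hz⟩)) hyz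
    simp only [wt] at h1
    rw [h4, h2] at h1
    omega

theorem card_le_of_dominating [Fintype V] [DecidableEq V] (G : SimpleGraph V) [DecidableRel G.Adj]
    (hL : (G.lapMatrix ℝ).IsHermitian) (μ : ℝ) (hmax : ∀ i : V, hL.eigenvalues i ≤ μ)
    (Γ : Finset V) (hdom : IsDominatingSet G Γ) (hlt : Γ.card < Fintype.card V) :
    (Fintype.card V : ℝ) ≤ μ * Γ.card := by
  set n : ℝ := (Fintype.card V : ℝ) with hn
  set k : ℝ := (Γ.card : ℝ) with hk
  have hkn : k < n := by rw [hn, hk]; exact_mod_cast hlt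
  have hk0 : 0 ≤ k := by rw [hk]; positivity
  let x : V → ℝ := fun v => if v ∈ Γ then n - k else - k
  have hxx : x ⬝ᵥ x = k * (n - k) * n := by
    have h1 : x ⬝ᵥ x = ∑ v, if v ∈ Γ then (n - k) ^ 2 else k ^ 2 := by
      simp only [dotProduct, x]
      refine Finset.sum_congr rfl fun v _ => ?_
      split_ifs <;> ring
    have h2 : ((Finset.univ.filter (fun v => v ∉ Γ)).card : ℝ) = n - k := by
      have : Finset.univ.filter (fun v => v ∉ Γ) = Γᶜ := by ext; simp
      rw [this, Finset.card_compl, Nat.cast_sub (Finset.card_le_univ _)]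
    rw [h1, Finset.sum_ite, Finset.sum_const, Finset.sum_const, nsmul_eq_mul, nsmul_eq_mul, h2]
    have : Finset.univ.filter (fun v => v ∈ Γ) = Γ := by ext; simp
    rw [this]
    ring
  have hR := rayleigh_aux _ hL μ hmax x
  rw [← Matrix.toLinearMap₂'_apply', lapMatrix_toLinearMap₂', hxx] at hR
  -- lower bound
  let f : V → V → ℝ := fun i j => if i ∉ Γ ∧ j ∈ Γ ∧ G.Adj i j then n ^ 2 else 0
  have hf0 : ∀ i j, 0 ≤ f i j := by
    intro i j
    simp only [f]
    split_ifs <;> positivity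
  have hf : n ^ 2 * (n - k) ≤ ∑ i, ∑ j, f i j := by
    have h1 : ∑ i ∈ Γᶜ, n ^ 2 ≤ ∑ i ∈ Γᶜ, ∑ j, f i j := by
      refine Finset.sum_le_sum fun i hi => ?_
      rw [Finset.mem_compl] at hi
      obtain ⟨u, hu, hiu⟩ := hdom i hi
      have h2 : f i u = n ^ 2 := by simp [f, hi, hu, hiu]
      rw [← h2]
      exact Finset.single_le_sum (f := fun j => f i j) (fun j _ => hf0 i j) (Finset.mem_univ u)
    have h2 : ∑ i ∈ Γᶜ, ∑ j, f i j ≤ ∑ i, ∑ j, f i j :=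
      Finset.sum_le_sum_of_subset_of_nonneg (Finset.subset_univ _)
        (fun i _ _ => Finset.sum_nonneg fun j _ => hf0 i j)
    rw [Finset.sum_const, nsmul_eq_mul, Finset.card_compl,
      Nat.cast_sub (Finset.card_le_univ _)] at h1
    linarith
  have hsum : ∑ i, ∑ j, f i j + ∑ i, ∑ j, f i j ≤
      ∑ i : V, ∑ j : V, if G.Adj i j then (x i - x j) ^ 2 else 0 := by
    conv_lhs => enter [2]; rw [Finset.sum_comm]
    simp only [← Finset.sum_add_distrib]
    refine Finset.sum_le_sum fun i _ => Finset.sum_le_sum fun j _ => ?_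
    have hs := G.adj_comm i j
    by_cases ha : G.Adj i j
    · have hb := hs.1 ha
      by_cases hi : i ∈ Γ <;> by_cases hj : j ∈ Γ <;> simp [f, x, ha, hb, hi, hj]
      apply le_of_eq
      ring
    · have hb : ¬ G.Adj j i := fun h => ha (hs.2 h)
      simp [f, ha, hb]
  have hfin : n ^ 2 * (n - k) ≤ μ * (k * (n - k) * n) := by linarith
  have hpos : 0 < n * (n - k) := mul_pos (by linarith) (by linarith)
  refine le_of_mul_le_mul_left ?_ hpos
  linarith

/-- If `G` is connected of order `n ≥ 2` and `μ` is the largest eigenvalue of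
the Laplacian matrix of `G`, then `β(G) ≤ n - n / μ`. -/
theorem metricDimension_le_card_sub_card_div_largest_lapMatrix_eigenvalue
    [Fintype V] [DecidableEq V] (G : SimpleGraph V) [DecidableRel G.Adj]
    (hG : G.Connected) (hn : 2 ≤ Fintype.card V)
    (hL : (G.lapMatrix ℝ).IsHermitian) (μ : ℝ)
    (hmem : ∃ i : V, hL.eigenvalues i = μ) (hmax : ∀ i : V, hL.eigenvalues i ≤ μ) :
    (metricDimension G : ℝ) ≤ (Fintype.card V : ℝ) - (Fintype.card V : ℝ) / μ := by
  have : Nontrivial V := Fintype.one_lt_card_iff_nontrivial.1 (by omega)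
  obtain ⟨Γ, hdom, hpriv⟩ := exists_dominating_private G
    (fun v => hG.preconnected.exists_adj_of_nontrivial v)
  have hlt : Γ.card < Fintype.card V := by
    rw [Finset.card_lt_iff_ne_univ]
    rintro rfl
    obtain ⟨v⟩ := hG.nonempty
    obtain ⟨w, hw, -⟩ := hpriv v (Finset.mem_univ _)
    exact hw (Finset.mem_univ _)
  have hle := card_le_of_dominating G hL μ hmax Γ hdom hlt
  have hres : IsResolvingSet G Γᶜ := by
    intro u v huv
    by_cases hu : u ∈ Γ
    · by_cases hv : v ∈ Γ
      · obtain ⟨w, hw, huw, hp⟩ := hpriv u hu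
        refine ⟨w, by simpa using hw, ?_⟩
        rw [SimpleGraph.dist_eq_one_iff_adj.2 huw]
        intro h
        exact huv (hp v hv (SimpleGraph.dist_eq_one_iff_adj.1 h.symm)).symm
      · refine ⟨v, by simpa using hv, ?_⟩
        rw [SimpleGraph.dist_self]
        exact fun h => huv (hG.dist_eq_zero_iff.1 h)
    · refine ⟨u, by simpa using hu, ?_⟩
      rw [SimpleGraph.dist_self]
      exact fun h => huv (hG.dist_eq_zero_iff.1 h.symm).symm
  have hb : metricDimension G ≤ Γᶜ.card := Nat.sInf_le ⟨_, hres, rfl⟩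
  have hb' : (metricDimension G : ℝ) ≤ (Fintype.card V : ℝ) - Γ.card := by
    rw [← Nat.cast_sub hlt.le, ← Finset.card_compl]
    exact_mod_cast hb
  have hnpos : (0 : ℝ) < Fintype.card V := by
    have : 0 < Fintype.card V := by omega
    exact_mod_cast this
  have hμ : 0 < μ := by
    by_contra h
    have h1 : μ * (Γ.card : ℝ) ≤ 0 :=
      mul_nonpos_of_nonpos_of_nonneg (not_lt.1 h) (Nat.cast_nonneg _)
    linarith
  have : (Fintype.card V : ℝ) / μ ≤ Γ.card := by
    rw [div_le_iff₀ hμ]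
    linarith
  linarith
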